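/- Let k be a positive integer, let a < b be real numbers, and let f : [a,b] → ℝ be continuously differentiable with f(a) = f(b) = 0. Suppose λ ∈ (a,b) is the unique zero of f' in [a,b]. Then ∫_a^b |f'(t)| · |f(t)|^{2k−1} dt = f(λ)^{2k} / k. -/

import Mathlib

/-- If `f` vanishes at `c` and `f' ≥ 0` on `(c,d)`, then
`∫_c^d |f'| |f|^(2k-1) = f(d)^(2k) / (2k)`. -/
lemma integral_abs_deriv_mul_pow_of_nonneg {k : ℕ} (hk : 0 < k) {c d : ℝ} (hcd : c ≤ d)
    {f f' : ℝ → ℝ} (hderiv : ∀ t ∈ Set.Icc c d, HasDerivAt f (f' t) t)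
    (hcont : ContinuousOn f' (Set.Icc c d)) (hfc : f c = 0)
    (hpos : ∀ t ∈ Set.Ioo c d, 0 ≤ f' t) :
    (∫ t in c..d, |f' t| * |f t| ^ (2 * k - 1)) = f d ^ (2 * k) / (2 * k) := by
  have hf : ContinuousOn f (Set.Icc c d) := HasDerivAt.continuousOn hderiv
  have hmono : MonotoneOn f (Set.Icc c d) := by
    refine monotoneOn_of_hasDerivWithinAt_nonneg (f' := f') (convex_Icc c d) hf ?_ ?_
    · exact fun t ht => (hderiv t (interior_subset ht)).hasDerivWithinAt
    · simpa only [interior_Icc] using hpos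
  have hcongr : Set.EqOn (fun t => |f' t| * |f t| ^ (2 * k - 1))
      (fun t => f t ^ (2 * k - 1) * f' t) (Set.Ioo c d) := by
    intro t ht
    have h0 : 0 ≤ f t :=
      hfc ▸ hmono (Set.left_mem_Icc.2 hcd) (Set.Ioo_subset_Icc_self ht) ht.1.le
    simp only [abs_of_nonneg h0, abs_of_nonneg (hpos t ht), mul_comm]
  rw [intervalIntegral.integral_of_le hcd, MeasureTheory.integral_Ioc_eq_integral_Ioo,
    MeasureTheory.setIntegral_congr_fun measurableSet_Ioo hcongr,
    ← MeasureTheory.integral_Ioc_eq_integral_Ioo, ← intervalIntegral.integral_of_le hcd]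
  rw [← Set.uIcc_of_le hcd] at hderiv hcont
  have h := intervalIntegral.integral_comp_mul_deriv (g := fun u => u ^ (2 * k - 1))
    hderiv hcont (by fun_prop)
  simp only [Function.comp_apply] at h
  have hk1 : 2 * k - 1 + 1 = 2 * k := by omega
  have hk2 : ((2 * k - 1 : ℕ) : ℝ) + 1 = 2 * k := by exact_mod_cast hk1
  rw [h, integral_pow, hk1, hk2, hfc, zero_pow (by omega), sub_zero]

/-- If `f` vanishes at `c` and `f'` has no zero in `(c,d)`, then
`∫_c^d |f'| |f|^(2k-1) = f(d)^(2k) / (2k)`. -/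
lemma integral_abs_deriv_mul_pow_of_left_zero {k : ℕ} (hk : 0 < k) {c d : ℝ} (hcd : c ≤ d)
    {f f' : ℝ → ℝ} (hderiv : ∀ t ∈ Set.Icc c d, HasDerivAt f (f' t) t)
    (hcont : ContinuousOn f' (Set.Icc c d)) (hfc : f c = 0)
    (hne : ∀ t ∈ Set.Ioo c d, f' t ≠ 0) :
    (∫ t in c..d, |f' t| * |f t| ^ (2 * k - 1)) = f d ^ (2 * k) / (2 * k) := by
  rcases hasDerivWithinAt_forall_lt_or_forall_gt_of_forall_ne (convex_Ioo c d)
    (fun t ht => (hderiv t (Set.Ioo_subset_Icc_self ht)).hasDerivWithinAt) hne with hneg | hpos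
  · have h := integral_abs_deriv_mul_pow_of_nonneg hk hcd (f := fun t => -f t)
      (f' := fun t => -f' t) (fun t ht => (hderiv t ht).neg) hcont.neg (by simp [hfc])
      (fun t ht => neg_nonneg.2 (hneg t ht).le)
    simpa only [abs_neg, (even_two_mul k).neg_pow] using h
  · exact integral_abs_deriv_mul_pow_of_nonneg hk hcd hderiv hcont hfc
      (fun t ht => (hpos t ht).le)

/-- If `f` vanishes at `d` and `f'` has no zero in `(c,d)`, then
`∫_c^d |f'| |f|^(2k-1) = f(c)^(2k) / (2k)`. -/
lemma integral_abs_deriv_mul_pow_of_right_zero {k : ℕ} (hk : 0 < k) {c d : ℝ} (hcd : c ≤ d)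
    {f f' : ℝ → ℝ} (hderiv : ∀ t ∈ Set.Icc c d, HasDerivAt f (f' t) t)
    (hcont : ContinuousOn f' (Set.Icc c d)) (hfd : f d = 0)
    (hne : ∀ t ∈ Set.Ioo c d, f' t ≠ 0) :
    (∫ t in c..d, |f' t| * |f t| ^ (2 * k - 1)) = f c ^ (2 * k) / (2 * k) := by
  have hmem : ∀ t ∈ Set.Icc (-d) (-c), -t ∈ Set.Icc c d :=
    fun t ht => ⟨le_neg.1 ht.2, neg_le.1 ht.1⟩
  have h := integral_abs_deriv_mul_pow_of_left_zero hk (neg_le_neg hcd)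
    (f := fun t => f (-t)) (f' := fun t => -f' (-t))
    (fun t ht => by
      simpa [Function.comp_def] using (hderiv (-t) (hmem t ht)).comp t (hasDerivAt_neg t))
    (hcont.comp continuousOn_neg hmem).neg (by simpa using hfd)
    (fun t ht => neg_ne_zero.2 (hne (-t) ⟨lt_neg.1 ht.2, neg_lt.1 ht.1⟩))
  simpa only [abs_neg, neg_neg,
    intervalIntegral.integral_comp_neg (fun t => |f' t| * |f t| ^ (2 * k - 1))] using h

/-- Let `k` be a positive integer, `a < b`, and let `f : ℝ → ℝ` be continuously
differentiable on `[a,b]` with derivative `f'` and `f(a) = f(b) = 0`. If `λ ∈ (a,b)` is the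
unique zero of `f'` in `[a,b]`, then `∫_a^b |f'(t)| |f(t)|^(2k-1) dt = f(λ)^(2k) / k`. -/
theorem integral_abs_deriv_mul_pow (k : ℕ) (hk : 0 < k) (a b : ℝ) (hab : a < b)
    (f f' : ℝ → ℝ)
    (hderiv : ∀ t ∈ Set.Icc a b, HasDerivAt f (f' t) t)
    (hcont : ContinuousOn f' (Set.Icc a b))
    (hfa : f a = 0) (hfb : f b = 0)
    (lam : ℝ) (hlam : lam ∈ Set.Ioo a b) (hlam0 : f' lam = 0)
    (huniq : ∀ t ∈ Set.Icc a b, f' t = 0 → t = lam) :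
    (∫ t in a..b, |f' t| * |f t| ^ (2 * k - 1)) = f lam ^ (2 * k) / k := by
  have hl : Set.Icc a lam ⊆ Set.Icc a b := Set.Icc_subset_Icc_right hlam.2.le
  have hr : Set.Icc lam b ⊆ Set.Icc a b := Set.Icc_subset_Icc_left hlam.1.le
  have hf : ContinuousOn f (Set.Icc a b) := HasDerivAt.continuousOn hderiv
  have hint : ContinuousOn (fun t => |f' t| * |f t| ^ (2 * k - 1)) (Set.Icc a b) :=
    hcont.abs.mul (hf.abs.pow _)
  rw [← intervalIntegral.integral_add_adjacent_intervals
      ((hint.mono hl).intervalIntegrable_of_Icc hlam.1.le)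
      ((hint.mono hr).intervalIntegrable_of_Icc hlam.2.le),
    integral_abs_deriv_mul_pow_of_left_zero hk hlam.1.le (fun t ht => hderiv t (hl ht))
      (hcont.mono hl) hfa
      (fun t ht h0 => ht.2.ne (huniq t (hl (Set.Ioo_subset_Icc_self ht)) h0)),
    integral_abs_deriv_mul_pow_of_right_zero hk hlam.2.le (fun t ht => hderiv t (hr ht))
      (hcont.mono hr) hfb
      (fun t ht h0 => ht.1.ne' (huniq t (hr (Set.Ioo_subset_Icc_self ht)) h0))]
  field_simp
  ring
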